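/- Let n ≥ 5 be an integer. There exists a constant c > 0, depending only on n, with the following property: for every ε ∈ (0,1) and every four times continuously differentiable positive solution v : ℝ → ℝ of the Delaunay ODE with v(0) = ε, v'(0) = 0, v'''(0) = 0, and 0 < v(t) ≤ ε·e^(((n−4)/2)·|t|) for all t ∈ ℝ, one has, for all t ≥ 0, |v'(t) − ((n−4)/2)·α·sinh(((n−4)/2)·t) − (n/2)·β·sinh((n/2)·t)| ≤ c·ε^((n+4)/(n−4))·e^(((n+4)/2)·t), where α := (1/(2(n−2)))·((n²/4)·ε − v''(0)) and β := (1/(2(n−2)))·(v''(0) − ((n−4)²/4)·ε). -/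

import Mathlib

theorem aux_half (l g M : ℝ) (hgl : l < g) (hM : 0 ≤ M) (y y' : ℝ → ℝ)
    (hy : ∀ t, HasDerivAt y (y' t) t) (h0 : y 0 = 0)
    (hb : ∀ t, 0 ≤ t → y' t - l * y t ≤ M * Real.exp (g * t)) :
    ∀ t, 0 ≤ t → y t ≤ M / (g - l) * Real.exp (g * t) := by
  intro t ht
  have hd : ∀ s, HasDerivAt
      (fun s => Real.exp (-l * s) * y s - M / (g - l) * Real.exp ((g - l) * s))
      (Real.exp (-l * s) * (y' s - l * y s - M * Real.exp (g * s))) s := by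
    intro s
    have e1 : HasDerivAt (fun s => Real.exp (-l * s)) (Real.exp (-l * s) * (-l * 1)) s :=
      ((hasDerivAt_id s).const_mul (-l)).exp
    have e2 : HasDerivAt (fun s => Real.exp ((g - l) * s))
        (Real.exp ((g - l) * s) * ((g - l) * 1)) s :=
      ((hasDerivAt_id s).const_mul (g - l)).exp
    have h := (e1.mul (hy s)).sub (e2.const_mul (M / (g - l)))
    refine h.congr_deriv ?_
    have e3 : Real.exp ((g - l) * s) = Real.exp (-l * s) * Real.exp (g * s) := by
      rw [← Real.exp_add]; ring_nf
    have : g - l ≠ 0 := by linarith [hgl]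
    rw [e3]
    field_simp
    ring
  have hanti : AntitoneOn
      (fun s => Real.exp (-l * s) * y s - M / (g - l) * Real.exp ((g - l) * s)) (Set.Ici 0) := by
    apply antitoneOn_of_deriv_nonpos (convex_Ici 0)
    · exact fun s _ => (hd s).continuousAt.continuousWithinAt
    · exact fun s _ => (hd s).differentiableAt.differentiableWithinAt
    · intro s hs
      rw [interior_Ici] at hs
      rw [(hd s).deriv]
      exact mul_nonpos_of_nonneg_of_nonpos (Real.exp_pos _).le (by linarith [hb s (le_of_lt hs)])
  have h1 := hanti (Set.mem_Ici.2 le_rfl) (Set.mem_Ici.2 ht) ht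
  simp only [h0, mul_zero, Real.exp_zero, mul_one, zero_sub] at h1
  have h2 : 0 ≤ M / (g - l) := div_nonneg hM (by linarith)
  have h3 : Real.exp (-l * t) * y t ≤ M / (g - l) * Real.exp ((g - l) * t) := by linarith
  have e4 : Real.exp ((g - l) * t) = Real.exp (-l * t) * Real.exp (g * t) := by
    rw [← Real.exp_add]; ring_nf
  rw [e4] at h3
  refine le_of_mul_le_mul_left ?_ (Real.exp_pos (-l * t))
  linarith

theorem aux_full (l g M : ℝ) (hgl : l < g) (hM : 0 ≤ M) (y y' : ℝ → ℝ)
    (hy : ∀ t, HasDerivAt y (y' t) t) (h0 : y 0 = 0)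
    (hb : ∀ t, 0 ≤ t → |y' t - l * y t| ≤ M * Real.exp (g * t)) :
    ∀ t, 0 ≤ t → |y t| ≤ M / (g - l) * Real.exp (g * t) := by
  intro t ht
  rw [abs_le']
  refine ⟨aux_half l g M hgl hM y y' hy h0 (fun s hs => (abs_le'.1 (hb s hs)).1) t ht,
    aux_half l g M hgl hM (fun s => - y s) (fun s => - y' s) (fun s => (hy s).neg) (by simp [h0])
      (fun s hs => ?_) t ht⟩
  have := (abs_le'.1 (hb s hs)).2
  linarith

theorem aux_four (a b g M : ℝ) (ha : 0 < a) (hab : a < b) (hbg : b < g) (hM : 0 ≤ M)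
    (z0 z1 z2 z3 z4 : ℝ → ℝ)
    (h0 : ∀ t, HasDerivAt z0 (z1 t) t) (h1 : ∀ t, HasDerivAt z1 (z2 t) t)
    (h2 : ∀ t, HasDerivAt z2 (z3 t) t) (h3 : ∀ t, HasDerivAt z3 (z4 t) t)
    (i0 : z0 0 = 0) (i1 : z1 0 = 0) (i2 : z2 0 = 0) (i3 : z3 0 = 0)
    (hb : ∀ t, 0 ≤ t → |z4 t - (a^2 + b^2) * z2 t + a^2 * b^2 * z0 t| ≤ M * Real.exp (g * t)) :
    ∀ t, 0 ≤ t → |z1 t| ≤ (M / (g - a) / (g - -a) / (g - b) +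
      b * (M / (g - a) / (g - -a) / (g - b) / (g - -b))) * Real.exp (g * t) := by
  have p1 : 0 < g - a := by linarith
  have p2 : 0 < g - -a := by linarith
  have p3 : 0 < g - b := by linarith
  have A1 := aux_full a g M (by linarith) hM
    (fun t => z3 t - b^2 * z1 t + a * (z2 t - b^2 * z0 t))
    (fun t => z4 t - b^2 * z2 t + a * (z3 t - b^2 * z1 t))
    (fun t => ((h3 t).sub ((h1 t).const_mul _)).add
      (((h2 t).sub ((h0 t).const_mul _)).const_mul _))
    (by simp [i0, i1, i2, i3])
    (fun t ht => by
      refine le_trans (le_of_eq ?_) (hb t ht)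
      congr 1; ring)
  have A2 := aux_full (-a) g (M / (g - a)) (by linarith) (by positivity)
    (fun t => z2 t - b^2 * z0 t) (fun t => z3 t - b^2 * z1 t)
    (fun t => (h2 t).sub ((h0 t).const_mul _)) (by simp [i0, i2])
    (fun t ht => by
      refine le_trans (le_of_eq ?_) (A1 t ht)
      congr 1; ring)
  have A3 := aux_full b g (M / (g - a) / (g - -a)) (by linarith) (by positivity)
    (fun t => z1 t + b * z0 t) (fun t => z2 t + b * z1 t)
    (fun t => (h1 t).add ((h0 t).const_mul _)) (by simp [i0, i1])
    (fun t ht => by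
      refine le_trans (le_of_eq ?_) (A2 t ht)
      congr 1; ring)
  have A4 := aux_full (-b) g (M / (g - a) / (g - -a) / (g - b)) (by linarith) (by positivity)
    z0 z1 h0 i0
    (fun t ht => by
      refine le_trans (le_of_eq ?_) (A3 t ht)
      congr 1; ring)
  intro t ht
  have B3 := A3 t ht
  have B4 := A4 t ht
  have hb0 : 0 < b := by linarith
  calc |z1 t| = |(z1 t + b * z0 t) - b * z0 t| := by congr 1; ring
    _ ≤ |z1 t + b * z0 t| + |b * z0 t| := abs_sub _ _
    _ = |z1 t + b * z0 t| + b * |z0 t| := by rw [abs_mul, abs_of_pos hb0]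
    _ ≤ _ := by
      have := mul_le_mul_of_nonneg_left B4 hb0.le
      linarith

theorem aux_cosh (k A t : ℝ) :
    HasDerivAt (fun t => A * Real.cosh (k * t)) (k * A * Real.sinh (k * t)) t := by
  have h : HasDerivAt (fun t => Real.cosh (k * t)) (Real.sinh (k * t) * (k * 1)) t :=
    ((hasDerivAt_id t).const_mul k).cosh
  exact (h.const_mul A).congr_deriv (by ring)

theorem aux_sinh (k A t : ℝ) :
    HasDerivAt (fun t => A * Real.sinh (k * t)) (k * A * Real.cosh (k * t)) t := by
  have h : HasDerivAt (fun t => Real.sinh (k * t)) (Real.cosh (k * t) * (k * 1)) t :=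
    ((hasDerivAt_id t).const_mul k).sinh
  exact (h.const_mul A).congr_deriv (by ring)

/-- Uniform estimate for the derivative:
`|v'(t) - ((n-4)/2)·α·sinh(((n-4)/2)t) - (n/2)·β·sinh((n/2)t)| ≤
c·ε^((n+4)/(n-4))·e^(((n+4)/2)t)` for `t ≥ 0`, for positive `C⁴` Delaunay solutions with
`v(0) = ε ∈ (0,1)`, `v'(0) = v'''(0) = 0` and `v(t) ≤ ε·e^(((n-4)/2)|t|)`. -/
theorem stmt_10 (n : ℕ) (hn : 5 ≤ n) :
    ∃ c : ℝ, 0 < c ∧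
      ∀ ε : ℝ, ε ∈ Set.Ioo (0:ℝ) 1 →
        ∀ v : ℝ → ℝ, ContDiff ℝ 4 v → (∀ t, 0 < v t) →
          (∀ t : ℝ,
            iteratedDeriv 4 v t - (((n : ℝ)^2 - 4*(n : ℝ) + 8)/2) * iteratedDeriv 2 v t
              + ((n : ℝ)^2 * ((n : ℝ) - 4)^2 / 16) * v t
              - ((n : ℝ) * ((n : ℝ) - 4) * ((n : ℝ)^2 - 4) / 16)
                  * (v t) ^ (((n : ℝ) + 4)/((n : ℝ) - 4)) = 0) →
          v 0 = ε → deriv v 0 = 0 → iteratedDeriv 3 v 0 = 0 →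
          (∀ t : ℝ, v t ≤ ε * Real.exp (((n : ℝ) - 4)/2 * |t|)) →
          ∀ t : ℝ, 0 ≤ t →
            |deriv v t
              - ((n : ℝ) - 4)/2
                  * ((1/(2*((n : ℝ) - 2))) * ((n : ℝ)^2/4 * ε - iteratedDeriv 2 v 0))
                  * Real.sinh (((n : ℝ) - 4)/2 * t)
              - (n : ℝ)/2
                  * ((1/(2*((n : ℝ) - 2))) * (iteratedDeriv 2 v 0 - ((n : ℝ) - 4)^2/4 * ε))
                  * Real.sinh ((n : ℝ)/2 * t)|
            ≤ c * ε ^ (((n : ℝ) + 4)/((n : ℝ) - 4)) * Real.exp (((n : ℝ) + 4)/2 * t) := by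
  have hn' : (5:ℝ) ≤ n := by exact_mod_cast hn
  generalize (n:ℝ) = m at *
  set a : ℝ := (m - 4)/2 with ha
  set b : ℝ := m/2 with hbdef
  set g : ℝ := (m + 4)/2 with hg
  set p : ℝ := (m + 4)/(m - 4) with hp
  set K : ℝ := m * (m - 4) * (m^2 - 4) / 16 with hK
  have ha0 : 0 < a := by rw [ha]; linarith
  have hab : a < b := by rw [ha, hbdef]; linarith
  have hbg : b < g := by rw [hg, hbdef]; linarith
  have hm4 : 0 < m - 4 := by linarith
  have hK0 : 0 < K := by
    have : 0 < m^2 - 4 := by nlinarith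
    have : 0 < m := by linarith
    positivity
  have p1 : 0 < g - a := by linarith
  have p2 : 0 < g - -a := by linarith
  have p3 : 0 < g - b := by linarith
  have p4 : 0 < g - -b := by linarith
  have p5 : 0 < b := by linarith
  refine ⟨K / (g - a) / (g - -a) / (g - b) +
      b * (K / (g - a) / (g - -a) / (g - b) / (g - -b)), by positivity, ?_⟩
  rintro ε ⟨hε0, hε1⟩ v hv hpos hode hv0 hv1 hv3 hbd t ht
  have hD : ∀ k : ℕ, k < 4 → ∀ t, HasDerivAt (iteratedDeriv k v) (iteratedDeriv (k+1) v t) t := by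
    intro k hk t
    have := (hv.differentiable_iteratedDeriv k (by exact_mod_cast hk)) t
    rw [iteratedDeriv_succ]
    exact this.hasDerivAt
  set α : ℝ := (1/(2*(m - 2))) * (m^2/4 * ε - iteratedDeriv 2 v 0) with hα
  set β : ℝ := (1/(2*(m - 2))) * (iteratedDeriv 2 v 0 - (m - 4)^2/4 * ε) with hβ
  have hm2 : m - 2 ≠ 0 := by linarith
  have s0 : α + β = ε := by
    rw [hα, hβ]; field_simp; ring
  have s2 : a * (a * α) + b * (b * β) = iteratedDeriv 2 v 0 := by
    rw [hα, hβ, ha, hbdef]; field_simp; ring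
  have hp0 : 0 ≤ p := by rw [hp]; apply div_nonneg <;> linarith
  have hap : a * p = g := by rw [ha, hp, hg]; field_simp
  have key := aux_four a b g (K * ε ^ p) ha0 hab hbg (by positivity)
    (fun t => iteratedDeriv 0 v t - α * Real.cosh (a * t) - β * Real.cosh (b * t))
    (fun t => iteratedDeriv 1 v t - a * α * Real.sinh (a * t) - b * β * Real.sinh (b * t))
    (fun t => iteratedDeriv 2 v t - a * (a * α) * Real.cosh (a * t)
      - b * (b * β) * Real.cosh (b * t))
    (fun t => iteratedDeriv 3 v t - a * (a * (a * α)) * Real.sinh (a * t)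
      - b * (b * (b * β)) * Real.sinh (b * t))
    (fun t => iteratedDeriv 4 v t - a * (a * (a * (a * α))) * Real.cosh (a * t)
      - b * (b * (b * (b * β))) * Real.cosh (b * t))
    (fun t => ((hD 0 (by norm_num) t).sub (aux_cosh _ _ t)).sub (aux_cosh _ _ t))
    (fun t => ((hD 1 (by norm_num) t).sub (aux_sinh _ _ t)).sub (aux_sinh _ _ t))
    (fun t => ((hD 2 (by norm_num) t).sub (aux_cosh _ _ t)).sub (aux_cosh _ _ t))
    (fun t => ((hD 3 (by norm_num) t).sub (aux_sinh _ _ t)).sub (aux_sinh _ _ t))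
    (by simp [hv0]; linarith) (by simp [iteratedDeriv_one, hv1])
    (by simp; linarith) (by simp [hv3])
    (fun t ht => by
      have e : iteratedDeriv 4 v t - (a^2 + b^2) * iteratedDeriv 2 v t + a^2 * b^2 * v t
          = K * v t ^ p := by
        rw [← sub_eq_zero, ← hode t, ha, hbdef]; ring
      have e' : v t ^ p ≤ ε ^ p * Real.exp (g * t) := by
        have h1 := Real.rpow_le_rpow (hpos t).le (hbd t) hp0
        rw [Real.mul_rpow hε0.le (Real.exp_pos _).le, ← Real.exp_mul, abs_of_nonneg ht] at h1
        rwa [show a * t * p = g * t by rw [← hap]; ring] at h1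
      have e3 : 0 ≤ v t ^ p := Real.rpow_nonneg (hpos t).le _
      simp only [iteratedDeriv_zero]
      calc _ = |K * v t ^ p| := by rw [← e]; congr 1; ring
        _ = K * v t ^ p := abs_of_nonneg (by positivity)
        _ ≤ K * (ε ^ p * Real.exp (g * t)) := by gcongr
        _ = _ := by ring) t ht
  simp only [iteratedDeriv_one] at key
  refine key.trans (le_of_eq ?_)
  ring
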